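/- Let x ∈ (0,1], y ∈ [0,1], and let g : [0,1]^2 → ℝ be continuous. Then the limit as n → ∞ of n · Σ_{k=1}^{n} Σ_{l=0}^{n} p_{n,k}(x) p_{n,l}(y) R(n,k) g(k/n, l/n) equals 0. -/

import Mathlib

open Filter Finset

/-- Bernstein basis polynomial `p_{n,k}(x) = C(n,k) x^k (1-x)^{n-k}`. -/
noncomputable def bern (n k : ℕ) (x : ℝ) : ℝ := (n.choose k : ℝ) * x ^ k * (1 - x) ^ (n - k)

/-- `R(n,k) = k/n - √(k(k-1)/(n(n-1))) - 1/(2n) + k/(2n²)` -/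
noncomputable def R (n k : ℕ) : ℝ :=
  (k : ℝ) / n - Real.sqrt ((k * (k - 1)) / (n * (n - 1))) - 1 / (2 * n) + k / (2 * n ^ 2)

/-- The unit square `[0,1]²`. -/
def unitSquare : Set (ℝ × ℝ) := Set.Icc 0 1 ×ˢ Set.Icc 0 1

lemma bern_nonneg {n k : ℕ} {x : ℝ} (hx0 : 0 ≤ x) (hx1 : x ≤ 1) : 0 ≤ bern n k x := by
  have : 0 ≤ 1 - x := by linarith
  unfold bern
  positivity

lemma sum_bern (n : ℕ) (x : ℝ) : ∑ k ∈ range (n + 1), bern n k x = 1 := by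
  have h := add_pow x (1 - x) n
  rw [add_sub_cancel, one_pow] at h
  rw [h]
  refine sum_congr rfl fun k _ => ?_
  unfold bern
  ring

lemma one_sub_half_sub_half_sq_le_sqrt {t : ℝ} (ht0 : 0 ≤ t) (ht1 : t ≤ 1) :
    1 - t / 2 - t ^ 2 / 2 ≤ Real.sqrt (1 - t) := by
  apply Real.le_sqrt_of_sq_le
  have h : (1 - t) - (1 - t / 2 - t ^ 2 / 2) ^ 2 = (1 - t) * (t ^ 2 * (3 + t) / 4) := by ring
  have h' : 0 ≤ (1 - t) * (t ^ 2 * (3 + t) / 4) :=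
    mul_nonneg (by linarith) (by positivity)
  linarith

lemma sqrt_one_sub_le {t : ℝ} (ht : t ≤ 1) : Real.sqrt (1 - t) ≤ 1 - t / 2 := by
  apply Real.sqrt_le_iff.2
  constructor <;> nlinarith [sq_nonneg t]

lemma abs_R_le {n k : ℕ} (hn : 2 ≤ n) (hk : 1 ≤ k) (hkn : k ≤ n) :
    |R n k| ≤ 4 / (n * (k + 1)) := by
  have hn' : (2 : ℝ) ≤ n := by exact_mod_cast hn
  have hk' : (1 : ℝ) ≤ k := by exact_mod_cast hk
  have hkn' : (k : ℝ) ≤ n := by exact_mod_cast hkn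
  unfold R
  generalize (n : ℝ) = N at *
  generalize (k : ℝ) = K at *
  have hN : 0 < N := by linarith
  have hN1 : 0 < N - 1 := by linarith
  have hK : 0 < K := by linarith
  obtain ⟨t, ht⟩ : ∃ t, t = (N - K) / (K * (N - 1)) := ⟨_, rfl⟩
  have ht0 : 0 ≤ t := by
    rw [ht]
    exact div_nonneg (by linarith) (by positivity)
  have ht1 : t ≤ 1 := by
    rw [ht, div_le_one (by positivity)]
    nlinarith
  have hs : Real.sqrt ((K * (K - 1)) / (N * (N - 1))) = K / N * Real.sqrt (1 - t) := by
    have h : (K * (K - 1)) / (N * (N - 1)) = (K / N) ^ 2 * (1 - t) := by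
      rw [ht]
      field_simp
      ring
    rw [h, Real.sqrt_mul (by positivity), Real.sqrt_sq (by positivity)]
  have hKt : K * t * (N - 1) = N - K := by
    rw [ht]
    field_simp
  have hlo := one_sub_half_sub_half_sq_le_sqrt ht0 ht1
  have hup := sqrt_one_sub_le ht1
  rw [hs]
  generalize Real.sqrt (1 - t) = s at *
  have hR : K / N - K / N * s - 1 / (2 * N) + K / (2 * N ^ 2)
      = (K * (1 - s) - (N - K) / (2 * N)) / N := by
    field_simp
    ring
  have hb : 4 / (N * (K + 1)) = 4 / (K + 1) / N := by field_simp
  have hKt' : K * t * N = N - K + K * t := by linarith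
  have hKt1 : K * t ≤ 1 := by nlinarith
  have hdiff : (N - K) / (2 * N) = K * t / 2 - K * t / (2 * N) := by
    field_simp
    linarith
  have hpos : 0 ≤ K * (1 - s) - (N - K) / (2 * N) := by
    have : 0 ≤ K * t / (2 * N) := by positivity
    have : K * (t / 2) ≤ K * (1 - s) := mul_le_mul_of_nonneg_left (by linarith) hK.le
    linarith
  rw [hR, hb, abs_of_nonneg (div_nonneg hpos hN.le)]
  apply div_le_div_of_nonneg_right _ hN.le
  have h1 : K * (1 - s) ≤ K * (t / 2 + t ^ 2 / 2) :=
    mul_le_mul_of_nonneg_left (by linarith) hK.le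
  have h2 : K * t / (2 * N) ≤ 1 / (2 * K) := by
    rw [div_le_div_iff₀ (by positivity) (by positivity)]
    nlinarith
  have h3 : K * (t ^ 2 / 2) ≤ 1 / (2 * K) := by
    rw [le_div_iff₀ (by positivity)]
    have : (K * t) ^ 2 ≤ 1 := pow_le_one₀ (by positivity) hKt1
    nlinarith
  have h4 : 1 / (2 * K) + 1 / (2 * K) ≤ 4 / (K + 1) := by
    rw [← add_div, div_le_div_iff₀ (by positivity) (by positivity)]
    linarith
  linarith

lemma bern_div_succ {n k : ℕ} {x : ℝ} (hx : x ≠ 0) :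
    bern n k x / (k + 1) = bern (n + 1) (k + 1) x / ((n + 1) * x) := by
  have h : ((n : ℝ) + 1) * n.choose k = (n + 1).choose (k + 1) * (k + 1) := by
    exact_mod_cast Nat.add_one_mul_choose_eq n k
  have hk : (k : ℝ) + 1 ≠ 0 := by positivity
  have hn : (n : ℝ) + 1 ≠ 0 := by positivity
  unfold bern
  rw [Nat.add_sub_add_right, div_eq_div_iff hk (mul_ne_zero hn hx)]
  linear_combination x ^ (k + 1) * (1 - x) ^ (n - k) * h

lemma sum_bern_div_succ_le (n : ℕ) {x : ℝ} (hx0 : 0 < x) (hx1 : x ≤ 1) :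
    ∑ k ∈ Icc 1 n, bern n k x / (k + 1) ≤ 1 / ((n + 1) * x) := by
  calc ∑ k ∈ Icc 1 n, bern n k x / (k + 1)
      ≤ ∑ k ∈ range (n + 1), bern n k x / (k + 1) := by
        refine sum_le_sum_of_subset_of_nonneg (fun k hk => ?_) fun k _ _ =>
          div_nonneg (bern_nonneg hx0.le hx1) (by positivity)
        simp only [Finset.mem_Icc, Finset.mem_range] at *
        omega
    _ = (∑ k ∈ range (n + 1), bern (n + 1) (k + 1) x) / ((n + 1) * x) := by
        rw [sum_div]
        exact sum_congr rfl fun k _ => bern_div_succ hx0.ne'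
    _ ≤ 1 / ((n + 1) * x) := by
        apply div_le_div_of_nonneg_right _ (by positivity)
        have h := sum_bern (n + 1) x
        rw [sum_range_succ'] at h
        linarith [bern_nonneg (n := n + 1) (k := 0) hx0.le hx1]

theorem stmt_17 (x : ℝ) (hx : x ∈ Set.Ioc (0 : ℝ) 1) (y : ℝ) (hy : y ∈ Set.Icc (0 : ℝ) 1)
    (g : ℝ × ℝ → ℝ) (hg : ContinuousOn g unitSquare) :
    Tendsto (fun n : ℕ => (n : ℝ) * ∑ k ∈ Finset.Icc 1 n, ∑ l ∈ Finset.range (n + 1),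
        bern n k x * bern n l y * R n k * g ((k : ℝ) / n, (l : ℝ) / n))
      atTop (nhds 0) := by
  obtain ⟨hx0, hx1⟩ := hx
  obtain ⟨M, hM⟩ := (isCompact_Icc.prod isCompact_Icc :
    IsCompact unitSquare).exists_bound_of_continuousOn hg
  have hlim : Tendsto (fun n : ℕ => 4 * M / x * (1 / ((n : ℝ) + 1))) atTop (nhds 0) := by
    simpa using tendsto_one_div_add_atTop_nhds_zero_nat.const_mul (4 * M / x)
  refine squeeze_zero_norm' ?_ hlim
  filter_upwards [eventually_ge_atTop 2] with n hn
  have hn0 : (0 : ℝ) < n := by exact_mod_cast (by omega : 0 < n)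
  have hmem : ∀ {j : ℕ}, j ≤ n → (j : ℝ) / n ∈ Set.Icc (0 : ℝ) 1 := fun {j} hj =>
    ⟨by positivity, (div_le_one hn0).2 (by exact_mod_cast hj)⟩
  have hM0 : 0 ≤ M := (norm_nonneg _).trans (hM (0, 0) (by simp))
  have hterm : ∀ k ∈ Icc 1 n,
      ‖∑ l ∈ range (n + 1), bern n k x * bern n l y * R n k * g ((k : ℝ) / n, (l : ℝ) / n)‖
        ≤ 4 * M / n * (bern n k x / (k + 1)) := by
    intro k hk
    obtain ⟨hk1, hkn⟩ := Finset.mem_Icc.1 hk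
    have hbx : 0 ≤ bern n k x := bern_nonneg hx0.le hx1
    calc _ ≤ ∑ l ∈ range (n + 1), bern n k x * (4 / (n * (k + 1))) * M * bern n l y := by
          refine norm_sum_le_of_le _ fun l hl => ?_
          have hby : 0 ≤ bern n l y := bern_nonneg hy.1 hy.2
          have hgM : |g ((k : ℝ) / n, (l : ℝ) / n)| ≤ M :=
            hM _ ⟨hmem hkn, hmem (Nat.lt_succ_iff.1 (Finset.mem_range.1 hl))⟩
          have hRk := abs_R_le hn hk1 hkn
          rw [Real.norm_eq_abs, abs_mul, abs_mul, abs_mul, abs_of_nonneg hbx, abs_of_nonneg hby]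
          calc _ ≤ bern n k x * bern n l y * (4 / (n * (k + 1))) * M := by gcongr
            _ = _ := by ring
      _ = 4 * M / n * (bern n k x / (k + 1)) := by
          rw [← mul_sum, sum_bern]
          field_simp
  rw [norm_mul, Real.norm_of_nonneg hn0.le]
  calc _ ≤ (n : ℝ) * (4 * M / n * (1 / ((n + 1) * x))) := by
        gcongr
        refine (norm_sum_le_of_le _ hterm).trans ?_
        rw [← mul_sum]
        gcongr
        exact sum_bern_div_succ_le n hx0 hx1
    _ = 4 * M / x * (1 / ((n : ℝ) + 1)) := by field_simp
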